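/- Let X and Y be real Banach spaces, let K₁ : X → Y be a bounded linear operator, K₂ : X × X → Y a continuous bilinear map. For a bounded linear operator 𝒦₁ : Y → X and φ ∈ Y, define the reduced inverse Born series terms K̃₁ = 𝒦₁, K̃₂(φ₁,φ₂) = −𝒦₁(K₂(𝒦₁φ₁, 𝒦₁φ₂)), and K̃_j(φ₁,…,φ_j) = −K̃_{j−1}(K₂(𝒦₁φ₁,𝒦₁φ₂), K₁(𝒦₁φ₃), …, K₁(𝒦₁φ_j)) for j ≥ 3; and define the fast iterates η̃⁽⁰⁾ = 0, η̃⁽¹⁾ = 𝒦₁φ, η̃⁽ⁿ⁺¹⁾ = η̃⁽ⁿ⁾ − 𝒦₁(K₂(η̃⁽ⁿ⁾ − η̃⁽ⁿ⁻¹⁾, η̃⁽¹⁾)) for n ≥ 1. Then for every n ≥ 1 and all R, r > 0 there exists a constant C = C(n, R, r, ‖K₁‖, ‖K₂‖) such that for every bounded linear 𝒦₁ with ‖𝒦₁‖ ≤ R and every φ ∈ Y with ‖φ‖ ≤ r: ‖η̃⁽ⁿ⁾ − Σ_{j=1}^n K̃_j(φ,…,φ)‖ ≤ C · ‖𝒦₁∘K₁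 − I‖. -/

import Mathlib

/-- The terms of the reduced inverse Born series, with index shift:
`redK K₁ K₂ 𝒦₁ n = K̃_{n+1}`.  Explicitly `K̃₁ = 𝒦₁`,
`K̃₂(φ₁, φ₂) = -𝒦₁(K₂(𝒦₁φ₁, 𝒦₁φ₂))`, and for `j ≥ 3`
`K̃_j(φ₁, …, φ_j) = -K̃_{j-1}(K₂(𝒦₁φ₁, 𝒦₁φ₂), K₁(𝒦₁φ₃), …, K₁(𝒦₁φ_j))`. -/
noncomputable def redK {X Y : Type*} [NormedAddCommGroup X] [NormedSpace ℝ X]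
    [NormedAddCommGroup Y] [NormedSpace ℝ Y]
    (K₁ : X →L[ℝ] Y) (K₂ : X →L[ℝ] X →L[ℝ] Y) (𝒦₁ : Y →L[ℝ] X) :
    (n : ℕ) → (Fin (n + 1) → Y) → X
  | 0, φ => 𝒦₁ (φ 0)
  | 1, φ => -𝒦₁ (K₂ (𝒦₁ (φ 0)) (𝒦₁ (φ 1)))
  | n + 2, φ => -redK K₁ K₂ 𝒦₁ (n + 1)
      (Fin.cons (K₂ (𝒦₁ (φ 0)) (𝒦₁ (φ 1)))
        (fun i : Fin (n + 1) => K₁ (𝒦₁ (φ i.succ.succ))))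

/-- The fast iterative scheme: `η̃⁽⁰⁾ = 0`, `η̃⁽¹⁾ = 𝒦₁φ`, and
`η̃⁽ⁿ⁺¹⁾ = η̃⁽ⁿ⁾ - 𝒦₁(K₂(η̃⁽ⁿ⁾ - η̃⁽ⁿ⁻¹⁾, η̃⁽¹⁾))` for `n ≥ 1`. -/
noncomputable def fastIter {X Y : Type*} [NormedAddCommGroup X] [NormedSpace ℝ X]
    [NormedAddCommGroup Y] [NormedSpace ℝ Y]
    (𝒦₁ : Y →L[ℝ] X) (K₂ : X →L[ℝ] X →L[ℝ] Y) (φ : Y) : ℕ → X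
  | 0 => 0
  | 1 => 𝒦₁ φ
  | n + 2 => fastIter 𝒦₁ K₂ φ (n + 1) -
      𝒦₁ (K₂ (fastIter 𝒦₁ K₂ φ (n + 1) - fastIter 𝒦₁ K₂ φ n) (𝒦₁ φ))

section FastBorn

variable {X Y : Type*} [NormedAddCommGroup X] [NormedSpace ℝ X]
  [NormedAddCommGroup Y] [NormedSpace ℝ Y]

/-- One step of the fast scheme on the data side: `y ↦ -K₂(𝒦₁ y, x)`. -/
noncomputable def fastStep (K₂ : X →L[ℝ] X →L[ℝ] Y) (𝒦₁ : Y →L[ℝ] X) (x : X) : Y →L[ℝ] Y :=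
  -((K₂.flip x).comp 𝒦₁)

theorem fastStep_apply (K₂ : X →L[ℝ] X →L[ℝ] Y) (𝒦₁ : Y →L[ℝ] X) (x : X) (y : Y) :
    fastStep K₂ 𝒦₁ x y = -K₂ (𝒦₁ y) x := rfl

theorem norm_fastStep_le (K₂ : X →L[ℝ] X →L[ℝ] Y) {𝒦₁ : Y →L[ℝ] X} {x : X} {R u : ℝ}
    (h𝒦 : ‖𝒦₁‖ ≤ R) (hx : ‖x‖ ≤ u) : ‖fastStep K₂ 𝒦₁ x‖ ≤ ‖K₂‖ * u * R := by
  have hu : 0 ≤ u := (norm_nonneg x).trans hx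
  rw [fastStep, norm_neg]
  refine (ContinuousLinearMap.opNorm_comp_le _ _).trans ?_
  have h := K₂.flip.le_opNorm x
  rw [ContinuousLinearMap.opNorm_flip] at h
  have h' : ‖K₂.flip x‖ ≤ ‖K₂‖ * u := h.trans (by gcongr)
  gcongr

theorem norm_pow_le_pow {A : Y →L[ℝ] Y} {c : ℝ} (hA : ‖A‖ ≤ c) (n : ℕ) : ‖A ^ n‖ ≤ c ^ n := by
  have hc : 0 ≤ c := (norm_nonneg A).trans hA
  rcases n.eq_zero_or_pos with rfl | hn
  · rw [pow_zero, pow_zero]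
    exact ContinuousLinearMap.norm_id_le
  · exact (norm_pow_le' A hn).trans (by gcongr)

theorem fastIter_succ_sub (K₂ : X →L[ℝ] X →L[ℝ] Y) (𝒦₁ : Y →L[ℝ] X) (φ : Y) (n : ℕ) :
    fastIter 𝒦₁ K₂ φ (n + 1) - fastIter 𝒦₁ K₂ φ n = 𝒦₁ ((fastStep K₂ 𝒦₁ (𝒦₁ φ) ^ n) φ) := by
  induction n with
  | zero => simp [fastIter]
  | succ n ih =>
    rw [fastIter, ih, pow_succ', mul_apply_eq_comp, fastStep_apply, map_neg]
    abel

theorem fastIter_eq_sum (K₂ : X →L[ℝ] X →L[ℝ] Y) (𝒦₁ : Y →L[ℝ] X) (φ : Y) (n : ℕ) :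
    fastIter 𝒦₁ K₂ φ n =
      ∑ j ∈ Finset.range n, 𝒦₁ ((fastStep K₂ 𝒦₁ (𝒦₁ φ) ^ j) φ) := by
  simp_rw [← fastIter_succ_sub, Finset.sum_range_sub, fastIter, sub_zero]

theorem redK_succ_cons (K₁ : X →L[ℝ] Y) (K₂ : X →L[ℝ] X →L[ℝ] Y) (𝒦₁ : Y →L[ℝ] X)
    (n : ℕ) (y z : Y) :
    redK K₁ K₂ 𝒦₁ (n + 1) (Fin.cons y fun _ => z) =
      -redK K₁ K₂ 𝒦₁ n (Fin.cons (K₂ (𝒦₁ y) (𝒦₁ z)) fun _ => K₁ (𝒦₁ z)) := by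
  cases n with
  | zero => simp [redK]
  | succ n =>
    rw [redK]
    rfl

theorem exists_norm_redK_cons_sub_le (K₁ : X →L[ℝ] Y) (K₂ : X →L[ℝ] X →L[ℝ] Y)
    {R u : ℝ} (hR : 0 ≤ R) (hu : 0 ≤ u) (n : ℕ) :
    ∀ s t : ℝ, 0 ≤ s → 0 ≤ t → ∃ C : ℝ, 0 ≤ C ∧
      ∀ (𝒦₁ : Y →L[ℝ] X) (x : X) (y z : Y), ‖𝒦₁‖ ≤ R → ‖x‖ ≤ u → ‖y‖ ≤ s → ‖z‖ ≤ t →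
        ‖redK K₁ K₂ 𝒦₁ n (Fin.cons y fun _ => z) - 𝒦₁ ((fastStep K₂ 𝒦₁ x ^ n) y)‖ ≤
          C * (‖𝒦₁.comp K₁ - ContinuousLinearMap.id ℝ X‖ + ‖𝒦₁ z - x‖) := by
  induction n with
  | zero =>
    intro s t _ _
    exact ⟨0, le_rfl, fun 𝒦₁ x y z _ _ _ _ => by simp [redK]⟩
  | succ n ih =>
    intro s t hs ht
    obtain ⟨C, hC, h⟩ := ih (‖K₂‖ * (R * s) * (R * t)) (‖K₁‖ * (R * t))
      (by positivity) (by positivity)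
    set M := R * (‖K₂‖ * u * R) ^ n * (‖K₂‖ * (R * s))
    have hM : 0 ≤ M := by positivity
    refine ⟨C * (1 + R * t) + M, by positivity, fun 𝒦₁ x y z h𝒦 hx hy hz => ?_⟩
    set ε := ‖𝒦₁.comp K₁ - ContinuousLinearMap.id ℝ X‖
    set A := fastStep K₂ 𝒦₁ x
    have h𝒦y : ‖𝒦₁ y‖ ≤ R * s := 𝒦₁.le_of_opNorm_le_of_le h𝒦 hy
    have h𝒦z : ‖𝒦₁ z‖ ≤ R * t := 𝒦₁.le_of_opNorm_le_of_le h𝒦 hz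
    have hmain := h 𝒦₁ x (K₂ (𝒦₁ y) (𝒦₁ z)) (K₁ (𝒦₁ z)) h𝒦 hx
      ((K₂.le_opNorm₂ _ _).trans (by gcongr)) (K₁.le_opNorm_of_le h𝒦z)
    have hdev : ‖𝒦₁ (K₁ (𝒦₁ z)) - x‖ ≤ ε * (R * t) + ‖𝒦₁ z - x‖ := by
      have h1 : 𝒦₁ (K₁ (𝒦₁ z)) - x =
          (𝒦₁.comp K₁ - ContinuousLinearMap.id ℝ X) (𝒦₁ z) + (𝒦₁ z - x) := by
        simp
      rw [h1]
      exact (norm_add_le _ _).trans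
        (add_le_add_left (ContinuousLinearMap.le_opNorm_of_le _ h𝒦z) _)
    have hlin : ‖𝒦₁ ((A ^ n) (K₂ (𝒦₁ y) (𝒦₁ z - x)))‖ ≤ M * ‖𝒦₁ z - x‖ := by
      have hAn : ‖A ^ n‖ ≤ (‖K₂‖ * u * R) ^ n := norm_pow_le_pow (norm_fastStep_le K₂ h𝒦 hx) n
      have h2 : ‖K₂ (𝒦₁ y) (𝒦₁ z - x)‖ ≤ ‖K₂‖ * (R * s) * ‖𝒦₁ z - x‖ :=
        (K₂.le_opNorm₂ _ _).trans (by gcongr)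
      refine (𝒦₁.le_of_opNorm_le_of_le h𝒦 ((A ^ n).le_of_opNorm_le_of_le hAn h2)).trans_eq ?_
      simp only [M]
      ring
    have hsplit : redK K₁ K₂ 𝒦₁ (n + 1) (Fin.cons y fun _ => z) - 𝒦₁ ((A ^ (n + 1)) y) =
        -(redK K₁ K₂ 𝒦₁ n (Fin.cons (K₂ (𝒦₁ y) (𝒦₁ z)) fun _ => K₁ (𝒦₁ z)) -
            𝒦₁ ((A ^ n) (K₂ (𝒦₁ y) (𝒦₁ z)))) -
          𝒦₁ ((A ^ n) (K₂ (𝒦₁ y) (𝒦₁ z - x))) := by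
      have hAy : A y = -K₂ (𝒦₁ y) x := fastStep_apply K₂ 𝒦₁ x y
      rw [redK_succ_cons, pow_succ, mul_apply_eq_comp, hAy]
      simp only [map_neg, map_sub]
      abel
    rw [hsplit]
    have hε : 0 ≤ ε := norm_nonneg _
    have hδ : 0 ≤ ‖𝒦₁ z - x‖ := norm_nonneg _
    calc _ ≤ C * (ε + ‖𝒦₁ (K₁ (𝒦₁ z)) - x‖) + M * ‖𝒦₁ z - x‖ := by
          refine (norm_sub_le _ _).trans ?_
          rw [norm_neg]
          exact add_le_add hmain hlin
      _ ≤ C * (ε + (ε * (R * t) + ‖𝒦₁ z - x‖)) + M * ‖𝒦₁ z - x‖ := by gcongr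
      _ ≤ C * (ε + (ε * (R * t) + ‖𝒦₁ z - x‖)) + M * ‖𝒦₁ z - x‖ +
            (C * (R * t * ‖𝒦₁ z - x‖) + M * ε) := le_add_of_nonneg_right (by positivity)
      _ = (C * (1 + R * t) + M) * (ε + ‖𝒦₁ z - x‖) := by ring

end FastBorn

/-- **Theorem 6.6 (the fast iterates agree with the partial sums of the reduced
inverse Born series up to order `ε`).**  For every `n ≥ 1` and all `R, r > 0` there is
a constant `C = C(n, R, r, ‖K₁‖, ‖K₂‖)` such that for every `𝒦₁` with `‖𝒦₁‖ ≤ R` and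
every data `φ` with `‖φ‖ ≤ r`:
`‖η̃⁽ⁿ⁾ - Σ_{j=1}^n K̃_j(φ,…,φ)‖ ≤ C ‖𝒦₁∘K₁ - I‖`.
(Here `Σ_{j=1}^n K̃_j(φ,…,φ) = Σ_{j'=0}^{n-1} redK K₁ K₂ 𝒦₁ j' (φ,…,φ)`.) -/
theorem stmt_10 {X Y : Type*} [NormedAddCommGroup X] [NormedSpace ℝ X] [CompleteSpace X]
    [NormedAddCommGroup Y] [NormedSpace ℝ Y] [CompleteSpace Y]
    (K₁ : X →L[ℝ] Y) (K₂ : X →L[ℝ] X →L[ℝ] Y) :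
    ∀ n : ℕ, 1 ≤ n → ∀ R r : ℝ, 0 < R → 0 < r → ∃ C : ℝ,
      ∀ 𝒦₁ : Y →L[ℝ] X, ‖𝒦₁‖ ≤ R → ∀ φ : Y, ‖φ‖ ≤ r →
        ‖fastIter 𝒦₁ K₂ φ n -
            ∑ j ∈ Finset.range n, redK K₁ K₂ 𝒦₁ j (fun _ => φ)‖ ≤
          C * ‖𝒦₁.comp K₁ - ContinuousLinearMap.id ℝ X‖ := by
  intro n _ R r hR hr
  choose C _ hC using fun j => exists_norm_redK_cons_sub_le K₁ K₂ hR.le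
    (mul_nonneg hR.le hr.le) j r r hr.le hr.le
  refine ⟨∑ j ∈ Finset.range n, C j, fun 𝒦₁ h𝒦 φ hφ => ?_⟩
  rw [fastIter_eq_sum, ← Finset.sum_sub_distrib, Finset.sum_mul]
  refine norm_sum_le_of_le _ fun j _ => ?_
  have h := hC j 𝒦₁ (𝒦₁ φ) φ φ h𝒦 (𝒦₁.le_of_opNorm_le_of_le h𝒦 hφ) hφ hφ
  have hcons : (Fin.cons φ fun _ => φ : Fin (j + 1) → Y) = fun _ => φ :=
    Fin.cons_self_tail (fun _ : Fin (j + 1) => φ)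
  rwa [hcons, sub_self, norm_zero, add_zero, norm_sub_rev] at h
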